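/- arXiv:1702.00985 — 6 statements merged into one kernel-verified Lean document; each statement's English description precedes it below -/
import Mathlib

section
/- Let n be a natural number, Ω an open subset of ℂⁿ (functions Fin n → ℂ), and F a normal family of holomorphic functions on Ω, i.e. for every compact set K ⊆ Ω there is a constant C_K > 0 such that |f(x)| ≤ C_K for all f ∈ F and x ∈ K. Then for every compact set K ⊆ Ω there exists a constant A_K > 0 such that the operator norm of the complex Fréchet derivative satisfies ‖fderiv ℂ f x‖ ≤ A_K for all f ∈ F and all x ∈ K. -/
/-- On an open set `Ω ⊆ ℂⁿ`, a normal family `F` of holomorphic functions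
(uniformly bounded on each compact subset of `Ω`) has uniformly bounded derivatives on
each compact subset of `Ω`. -/
theorem normal_family_deriv_bound (n : ℕ) (Ω : Set (Fin n → ℂ)) (hΩ : IsOpen Ω)
    (F : Set ((Fin n → ℂ) → ℂ))
    (hhol : ∀ f ∈ F, DifferentiableOn ℂ f Ω)
    (hnormal : ∀ K : Set (Fin n → ℂ), K ⊆ Ω → IsCompact K →
      ∃ C : ℝ, 0 < C ∧ ∀ f ∈ F, ∀ x ∈ K, ‖f x‖ ≤ C) :
    ∀ K : Set (Fin n → ℂ), K ⊆ Ω → IsCompact K →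
      ∃ A : ℝ, 0 < A ∧ ∀ f ∈ F, ∀ x ∈ K, ‖fderiv ℂ f x‖ ≤ A := by
  intro K hKΩ hK
  obtain ⟨δ, hδ, hKδ⟩ := hK.exists_cthickening_subset_open hΩ hKΩ
  obtain ⟨C, hC, hFC⟩ := hnormal _ hKδ hK.cthickening
  refine ⟨2 * C / δ, by positivity, fun f hf x hx => ?_⟩
  have hball : Metric.ball x δ ⊆ Metric.cthickening δ K :=
    Metric.ball_subset_closedBall.trans (Metric.closedBall_subset_cthickening hx δ)
  refine Complex.norm_fderiv_le_div_of_mapsTo_ball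
    ((hhol f hf).mono (hball.trans hKδ)) (fun y hy => ?_) hδ
  rw [Metric.mem_closedBall, dist_eq_norm]
  linarith [norm_sub_le (f y) (f x), hFC f hf y (hball hy),
    hFC f hf x (hball (Metric.mem_ball_self hδ))]
end

section
/- Montel's theorem, sequential form: Let Ω be an open subset of ℂⁿ (functions Fin n → ℂ) and (f_j)_{j∈ℕ} a sequence of holomorphic functions on Ω which is a normal family, i.e. for every compact K ⊆ Ω there is C_K > 0 with |f_j(x)| ≤ C_K for all j and all x ∈ K. Then there exist a strictly increasing map φ : ℕ → ℕ and a holomorphic function f on Ω such that the subsequence (f_{φ(j)}) converges to f uniformly on every compact subset of Ω. -/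
open Filter Metric Set Topology

section HolomorphicFamilies

variable {ι E F : Type*} [NormedAddCommGroup E] [NormedAddCommGroup F]

/-- On a ball where it is bounded by `C`, a function takes values within `2 * C`
of its value at the center. -/
theorem mapsTo_closedBall_of_norm_le {f : E → F} {c : E} {r C : ℝ} (hr : 0 < r)
    (hC : ∀ z ∈ ball c r, ‖f z‖ ≤ C) : MapsTo f (ball c r) (closedBall (f c) (2 * C)) := by
  intro z hz
  rw [mem_closedBall, two_mul]
  exact (dist_le_norm_add_norm _ _).trans (add_le_add (hC z hz) (hC c (mem_ball_self hr)))

variable [NormedSpace ℂ E] [NormedSpace ℂ F]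

/-- Uniformly bounded holomorphic functions on a ball are equicontinuous at its center. -/
theorem equicontinuousAt_of_norm_le_on_ball {f : ι → E → F} {c : E} {r C : ℝ} (hr : 0 < r)
    (hf : ∀ i, DifferentiableOn ℂ (f i) (ball c r)) (hC : ∀ i, ∀ z ∈ ball c r, ‖f i z‖ ≤ C) :
    EquicontinuousAt f c := by
  refine Metric.equicontinuousAt_of_continuity_modulus (fun z ↦ 2 * C / r * dist z c) ?_ f ?_
  · have h : Continuous fun z ↦ 2 * C / r * dist z c := by fun_prop
    simpa using h.tendsto c
  · filter_upwards [ball_mem_nhds c hr] with z hz i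
    rw [dist_comm]
    exact Complex.dist_le_div_mul_dist_of_mapsTo_ball (hf i)
      (mapsTo_closedBall_of_norm_le hr (hC i)) hz

/-- If holomorphic functions form a uniform Cauchy sequence on a ball of radius `2 * r`, then their
derivatives form a uniform Cauchy sequence on the concentric ball of radius `r`. -/
theorem UniformCauchySeqOn.fderiv_on_ball {f : ι → E → F} {p : Filter ι} {c : E} {r : ℝ}
    (hr : 0 < r) (h : UniformCauchySeqOn f p (ball c (2 * r)))
    (hf : ∀ i, DifferentiableOn ℂ (f i) (ball c (2 * r))) :
    UniformCauchySeqOn (fun i ↦ fderiv ℂ (f i)) p (ball c r) := by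
  intro u hu
  obtain ⟨ε, hε, hεu⟩ := mem_uniformity_dist.1 hu
  filter_upwards [h _ (dist_mem_uniformity (show 0 < ε * r / 4 by positivity))] with m hm x hx
  have hsub : ball x r ⊆ ball c (2 * r) := ball_subset_ball' (by linarith [mem_ball.1 hx])
  have hd : ∀ i, DifferentiableAt ℂ (f i) x := fun i ↦
    (hf i).differentiableAt (isOpen_ball.mem_nhds (hsub (mem_ball_self hr)))
  have hle : ∀ z ∈ ball x r, ‖(f m.1 - f m.2) z‖ ≤ ε * r / 4 := fun z hz ↦ by
    simpa [dist_eq_norm_sub] using (hm z (hsub hz)).le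
  have key := Complex.norm_fderiv_le_div_of_mapsTo_ball
    (((hf m.1).sub (hf m.2)).mono hsub) (mapsTo_closedBall_of_norm_le hr hle) hr
  rw [fderiv_sub (hd _) (hd _), ← dist_eq_norm_sub] at key
  refine hεu (key.trans_lt ?_)
  rw [div_lt_iff₀ hr]
  nlinarith [mul_pos hε hr]

/-- A locally uniform limit of holomorphic functions on an open subset of a finite-dimensional
space is holomorphic. -/
theorem TendstoLocallyUniformlyOn.differentiableOn_of_properSpace [ProperSpace E]
    [CompleteSpace F] {f : ι → E → F} {g : E → F} {p : Filter ι} [p.NeBot] {U : Set E}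
    (h : TendstoLocallyUniformlyOn f g p U) (hU : IsOpen U)
    (hf : ∀ i, DifferentiableOn ℂ (f i) U) : DifferentiableOn ℂ g U := by
  intro x hx
  obtain ⟨R, hR, hRU⟩ := nhds_basis_closedBall.mem_iff.1 (hU.mem_nhds hx)
  obtain ⟨r, hr, rfl⟩ : ∃ r, 0 < r ∧ R = 2 * r := ⟨R / 2, by positivity, by ring⟩
  have hball : ball x (2 * r) ⊆ U := ball_subset_closedBall.trans hRU
  have hunif : TendstoUniformlyOn f g p (ball x (2 * r)) :=
    ((tendstoLocallyUniformlyOn_iff_forall_isCompact hU).1 h _ hRU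
      (isCompact_closedBall x _)).mono ball_subset_closedBall
  have hcauchy := hunif.uniformCauchySeqOn.fderiv_on_ball hr fun i ↦ (hf i).mono hball
  have hlim : ∀ y ∈ ball x r, ∃ l, Tendsto (fun i ↦ fderiv ℂ (f i) y) p (𝓝 l) :=
    fun y hy ↦ cauchy_map_iff_exists_tendsto.1 (hcauchy.cauchy_map hy)
  choose! g' hg' using hlim
  have hsub : ball x r ⊆ ball x (2 * r) := ball_subset_ball (by linarith)
  exact (hasFDerivAt_of_tendstoUniformlyOn isOpen_ball
    (hcauchy.tendstoUniformlyOn_of_tendsto hg')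
    (fun i y hy ↦ ((hf i).differentiableAt (hU.mem_nhds (hball (hsub hy)))).hasFDerivAt)
    (fun y hy ↦ hunif.tendsto_at (hsub hy))
    (mem_ball_self hr)).differentiableAt.differentiableWithinAt

end HolomorphicFamilies

/-- Sequential form of the **Arzelà-Ascoli theorem** for continuous functions on a locally
compact σ-compact space. -/
theorem ContinuousMap.exists_subseq_tendsto_of_equicontinuous {X α : Type*} [TopologicalSpace X]
    [WeaklyLocallyCompactSpace X] [SigmaCompactSpace X] [MetricSpace α] [CompleteSpace α]
    (f : ℕ → C(X, α)) (hf : Equicontinuous fun j ↦ (f j : X → α))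
    (hcomp : ∀ x, ∃ Q : Set α, IsCompact Q ∧ ∀ j, f j x ∈ Q) :
    ∃ (g : C(X, α)) (φ : ℕ → ℕ), StrictMono φ ∧ Tendsto (f ∘ φ) atTop (𝓝 g) := by
  have : T2Space (UniformOnFun X α {K | IsCompact K}) :=
    UniformOnFun.t2Space_of_covering sUnion_isCompact_eq_univ
  have hcompact : IsCompact (closure (range f)) := by
    refine ArzelaAscoli.isCompact_closure_of_isClosedEmbedding
      (𝔖 := {K : Set X | IsCompact K}) (F := fun h : C(X, α) ↦ (h : X → α)) (fun _ ↦ id)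
      ContinuousMap.isUniformEmbedding_toUniformOnFunIsCompact.isClosedEmbedding
      (fun K _ ↦ Equicontinuous.equicontinuousOn ?_ K) fun K _ x _ ↦ ?_
    · intro x u hu
      filter_upwards [hf x u hu] with y hy
      rintro ⟨_, j, rfl⟩
      exact hy j
    · obtain ⟨Q, hQ, hmem⟩ := hcomp x
      exact ⟨Q, hQ, forall_mem_range.2 hmem⟩
  obtain ⟨g, -, φ, hφ, hlim⟩ := hcompact.tendsto_subseq fun j ↦ subset_closure (mem_range_self j)
  exact ⟨g, φ, hφ, hlim⟩

/-- Montel's theorem, sequential form: a sequence of holomorphic functions on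
an open set `Ω ⊆ ℂⁿ` which is a normal family has a subsequence converging locally uniformly
on `Ω` to a holomorphic function. -/
theorem montel_sequential (n : ℕ) (Ω : Set (Fin n → ℂ)) (hΩ : IsOpen Ω)
    (f : ℕ → (Fin n → ℂ) → ℂ)
    (hhol : ∀ j : ℕ, DifferentiableOn ℂ (f j) Ω)
    (hnormal : ∀ K : Set (Fin n → ℂ), K ⊆ Ω → IsCompact K →
      ∃ C : ℝ, 0 < C ∧ ∀ j : ℕ, ∀ x ∈ K, ‖f j x‖ ≤ C) :
    ∃ φ : ℕ → ℕ, StrictMono φ ∧ ∃ g : (Fin n → ℂ) → ℂ, DifferentiableOn ℂ g Ω ∧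
      TendstoLocallyUniformlyOn (fun j => f (φ j)) g Filter.atTop Ω := by
  have : LocallyCompactSpace Ω := hΩ.locallyCompactSpace
  let F : ℕ → C(Ω, ℂ) := fun j ↦ ⟨Ω.domRestrict (f j), (hhol j).continuousOn.domRestrict⟩
  have hequi : Equicontinuous fun j ↦ (F j : Ω → ℂ) := by
    intro x
    obtain ⟨r, hr, hrΩ⟩ := nhds_basis_closedBall.mem_iff.1 (hΩ.mem_nhds x.2)
    obtain ⟨C, -, hC⟩ := hnormal _ hrΩ (isCompact_closedBall _ _)
    have hat : EquicontinuousAt f x := equicontinuousAt_of_norm_le_on_ball hr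
      (fun j ↦ (hhol j).mono (ball_subset_closedBall.trans hrΩ))
      fun j z hz ↦ hC j z (ball_subset_closedBall hz)
    exact fun u hu ↦ continuous_subtype_val.continuousAt.eventually (hat u hu)
  obtain ⟨G, φ, hφ, hlim⟩ := ContinuousMap.exists_subseq_tendsto_of_equicontinuous F hequi
    fun x ↦ by
      obtain ⟨C, -, hC⟩ := hnormal {x.1} (singleton_subset_iff.2 x.2) isCompact_singleton
      exact ⟨closedBall 0 C, isCompact_closedBall _ _, fun j ↦
        mem_closedBall_zero_iff.2 (hC j x rfl)⟩
  have hloc : TendstoLocallyUniformlyOn (fun j ↦ f (φ j)) (Function.extend Subtype.val G 0)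
      atTop Ω := by
    rw [tendstoLocallyUniformlyOn_iff_tendstoLocallyUniformly_comp_coe,
      Function.extend_comp Subtype.val_injective]
    exact ContinuousMap.tendsto_iff_tendstoLocallyUniformly.1 hlim
  exact ⟨φ, hφ, _, hloc.differentiableOn_of_properSpace hΩ fun j ↦ hhol (φ j), hloc⟩
end

section
/- Montel's theorem, compactness form: Let Ω be an open subset of ℂⁿ (functions Fin n → ℂ) and let C : {K : Set (Fin n → ℂ) // IsCompact K ∧ K ⊆ Ω} → ℝ be an assignment of bounds. Then the set of continuous maps f ∈ C(Ω, ℂ) (with the compact-open topology) whose underlying function is holomorphic on Ω and satisfies |f(x)| ≤ C(K) for every compact K ⊆ Ω and every x ∈ K, is a compact subset of C(Ω, ℂ). -/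
open Filter Topology Metric Set

/-- **Cauchy estimate** for the Fréchet derivative on a ball of half the radius. -/
theorem norm_fderiv_le_of_forall_mem_ball_norm_le {E F : Type*} [NormedAddCommGroup E]
    [NormedSpace ℂ E] [NormedAddCommGroup F] [NormedSpace ℂ F] {f : E → F} {c z : E} {R M : ℝ}
    (hf : DifferentiableOn ℂ f (ball c R)) (hM : ∀ w ∈ ball c R, ‖f w‖ ≤ M)
    (hR : 0 < R) (hz : z ∈ ball c (R / 2)) : ‖fderiv ℂ f z‖ ≤ 2 * M / (R / 2) := by
  have hsub : ball z (R / 2) ⊆ ball c R :=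
    ball_subset_ball' (by linarith [mem_ball.1 hz])
  refine Complex.norm_fderiv_le_div_of_mapsTo_ball (hf.mono hsub) (fun w hw ↦ ?_) (half_pos hR)
  rw [mem_closedBall, dist_eq_norm]
  linarith [norm_sub_le (f w) (f z), hM w (hsub hw), hM z (hsub (mem_ball_self (half_pos hR)))]

/-- A uniform limit of holomorphic functions on a ball is complex differentiable at its center. -/
theorem TendstoUniformlyOn.differentiableAt_of_ball {ι E F : Type*} [NormedAddCommGroup E]
    [NormedSpace ℂ E] [NormedAddCommGroup F] [NormedSpace ℂ F] [CompleteSpace F]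
    {l : Filter ι} [l.NeBot] {f : ι → E → F} {g : E → F} {c : E} {R : ℝ} (hR : 0 < R)
    (hfg : TendstoUniformlyOn f g l (ball c R))
    (hf : ∀ᶠ i in l, DifferentiableOn ℂ (f i) (ball c R)) : DifferentiableAt ℂ g c := by
  have hdiff {i : ι} (hi : DifferentiableOn ℂ (f i) (ball c R)) {z : E} (hz : z ∈ ball c (R / 2)) :
      DifferentiableAt ℂ (f i) z :=
    hi.differentiableAt (isOpen_ball.mem_nhds (ball_subset_ball (by linarith) hz))
  have hcauchy : UniformCauchySeqOn (fun i ↦ fderiv ℂ (f i)) l (ball c (R / 2)) := by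
    intro u hu
    obtain ⟨ε, hε, hεu⟩ := mem_uniformity_dist.1 hu
    have hpos : 0 < ε * R / 8 := by positivity
    filter_upwards [hfg.uniformCauchySeqOn _ (dist_mem_uniformity hpos), hf.prod_mk hf]
      with m hm hd z hz
    apply hεu
    rw [dist_eq_norm, ← fderiv_sub (hdiff hd.1 hz) (hdiff hd.2 hz)]
    refine (norm_fderiv_le_of_forall_mem_ball_norm_le (M := ε * R / 8) (hd.1.sub hd.2)
      (fun w hw ↦ ?_) hR hz).trans_lt ?_
    · simpa [dist_eq_norm] using (hm w hw).le
    · rw [div_lt_iff₀ (half_pos hR)]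
      nlinarith [mul_pos hε hR]
  have hlim (z : E) : ∃ L, z ∈ ball c (R / 2) → Tendsto (fun i ↦ fderiv ℂ (f i) z) l (𝓝 L) := by
    by_cases hz : z ∈ ball c (R / 2)
    · obtain ⟨L, hL⟩ := CompleteSpace.complete (hcauchy.cauchy_map hz)
      exact ⟨L, fun _ ↦ hL⟩
    · exact ⟨0, fun h ↦ absurd h hz⟩
  choose g' hg' using hlim
  have hunif := hcauchy.tendstoUniformlyOn_of_tendsto hg'
  have hnhds : ball c (R / 2) ∈ 𝓝 c := ball_mem_nhds c (half_pos hR)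
  refine (hasFDerivAt_of_tendstoUniformlyOnFilter (f := f) (g' := g') (l := l)
    (hunif.tendstoUniformlyOnFilter.mono_right (le_principal_iff.2 hnhds)) ?_ ?_).differentiableAt
  · filter_upwards [hf.prod_mk (eventually_mem_set.2 hnhds)] with p hp
    exact (hdiff hp.1 hp.2).hasFDerivAt
  · filter_upwards [ball_mem_nhds c hR] with y hy
    exact hfg.tendsto_at hy

/-- On an open subset of a proper complex normed space, the continuous maps that extend to
holomorphic functions form a closed set in the compact-open topology. -/
theorem ContinuousMap.isClosed_setOf_differentiableOn {E F : Type*} [NormedAddCommGroup E]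
    [NormedSpace ℂ E] [ProperSpace E] [NormedAddCommGroup F] [NormedSpace ℂ F] [CompleteSpace F]
    {Ω : Set E} (hΩ : IsOpen Ω) :
    IsClosed {f : C(Ω, F) | ∃ g : E → F, DifferentiableOn ℂ g Ω ∧ ∀ x : Ω, f x = g x} := by
  refine isClosed_of_closure_subset fun f hf ↦ ?_
  have := mem_closure_iff_nhdsWithin_neBot.1 hf
  let e (f : C(Ω, F)) : E → F := Function.extend Subtype.val f 0
  have he (f : C(Ω, F)) (x : Ω) : e f x = f x := Subtype.val_injective.extend_apply f 0 x
  refine ⟨e f, fun x hx ↦ ?_, fun x ↦ (he f x).symm⟩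
  obtain ⟨R, hR, hRΩ⟩ := nhds_basis_closedBall.mem_iff.1 (hΩ.mem_nhds hx)
  have hsub : ball x R ⊆ Ω := ball_subset_closedBall.trans hRΩ
  refine (TendstoUniformlyOn.differentiableAt_of_ball (f := e)
    (l := 𝓝[{f : C(Ω, F) | ∃ g : E → F, DifferentiableOn ℂ g Ω ∧ ∀ x : Ω, f x = g x}] f)
    hR ?_ ?_).differentiableWithinAt
  · have hK : IsCompact (Subtype.val ⁻¹' closedBall x R : Set Ω) := by
      rw [Subtype.isCompact_iff, Subtype.image_preimage_coe, inter_eq_right.2 hRΩ]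
      exact isCompact_closedBall x R
    have hid : Tendsto (fun k : C(Ω, F) ↦ k) (𝓝 f) (𝓝 f) := tendsto_id
    have h := ContinuousMap.tendsto_iff_forall_isCompact_tendstoUniformlyOn.1 hid _ hK
    intro u hu
    filter_upwards [nhdsWithin_le_nhds (h u hu)] with k hk y hy
    have := hk ⟨y, hsub hy⟩ (ball_subset_closedBall hy)
    rwa [← he, ← he] at this
  · filter_upwards [self_mem_nhdsWithin] with k ⟨g, hg, hkg⟩
    exact (hg.mono hsub).congr fun y hy ↦ (he k ⟨y, hsub hy⟩).trans (hkg ⟨y, hsub hy⟩)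

/-- Montel's theorem, compactness form: given bounds `C K` for each compact
`K ⊆ Ω`, the set of continuous maps `f ∈ C(Ω, ℂ)` that are holomorphic on `Ω` (i.e. extend
to a function differentiable on `Ω`) and satisfy `‖f x‖ ≤ C K` for all compact `K ⊆ Ω` and
`x ∈ K`, is compact in the compact-open topology. -/
theorem montel_compactness (n : ℕ) (Ω : Set (Fin n → ℂ)) (hΩ : IsOpen Ω)
    (C : {K : Set (Fin n → ℂ) // IsCompact K ∧ K ⊆ Ω} → ℝ) :
    IsCompact {f : C(Ω, ℂ) |
      (∃ g : (Fin n → ℂ) → ℂ, DifferentiableOn ℂ g Ω ∧ ∀ x : Ω, f x = g x) ∧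
      ∀ K : {K : Set (Fin n → ℂ) // IsCompact K ∧ K ⊆ Ω},
        ∀ x : Ω, (x : Fin n → ℂ) ∈ K.1 → ‖f x‖ ≤ C K} := by
  have : LocallyCompactSpace Ω := hΩ.locallyCompactSpace
  set S := {f : C(Ω, ℂ) |
      (∃ g : (Fin n → ℂ) → ℂ, DifferentiableOn ℂ g Ω ∧ ∀ x : Ω, f x = g x) ∧
      ∀ K : {K : Set (Fin n → ℂ) // IsCompact K ∧ K ⊆ Ω},
        ∀ x : Ω, (x : Fin n → ℂ) ∈ K.1 → ‖f x‖ ≤ C K}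
  have hclosed : IsClosed S := by
    refine (ContinuousMap.isClosed_setOf_differentiableOn hΩ).inter ?_
    change IsClosed {f : C(Ω, ℂ) | ∀ K : {K : Set (Fin n → ℂ) // IsCompact K ∧ K ⊆ Ω},
      ∀ x : Ω, (x : Fin n → ℂ) ∈ K.1 → ‖f x‖ ≤ C K}
    simp only [ofPred_forall]
    exact isClosed_iInter fun K ↦ isClosed_iInter fun x ↦ isClosed_iInter fun _ ↦
      isClosed_le (by fun_prop) continuous_const
  have hequi : Equicontinuous fun f : S ↦ (f : Ω → ℂ) := by
    intro x
    obtain ⟨R, hR, hRΩ⟩ := nhds_basis_closedBall.mem_iff.1 (hΩ.mem_nhds x.2)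
    have hsub : ball (x : Fin n → ℂ) R ⊆ Ω := ball_subset_closedBall.trans hRΩ
    let M := C ⟨closedBall x R, isCompact_closedBall _ _, hRΩ⟩
    refine equicontinuousAt_of_continuity_modulus (fun y ↦ 2 * M / R * dist y x) ?_ _ ?_
    · exact (by fun_prop : Continuous fun y : Ω ↦ 2 * M / R * dist y x).tendsto' _ _ (by simp)
    · filter_upwards [ball_mem_nhds x hR] with y hy f
      obtain ⟨⟨g, hg, hfg⟩, hM⟩ := f.2
      have hbound (w : Fin n → ℂ) (hw : w ∈ ball (x : Fin n → ℂ) R) : ‖g w‖ ≤ M := by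
        rw [← hfg ⟨w, hsub hw⟩]
        exact hM _ ⟨w, hsub hw⟩ (ball_subset_closedBall hw)
      rw [dist_comm, hfg, hfg]
      refine Complex.dist_le_div_mul_dist_of_mapsTo_ball (hg.mono hsub) (fun w hw ↦ ?_) hy
      rw [mem_closedBall, dist_eq_norm]
      linarith [norm_sub_le (g w) (g x), hbound w hw, hbound x (mem_ball_self hR)]
  have : T2Space (UniformOnFun Ω ℂ {K | IsCompact K}) :=
    UniformOnFun.t2Space_of_covering (sUnion_eq_univ_iff.2 fun x ↦ ⟨{x}, isCompact_singleton, rfl⟩)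
  rw [← hclosed.closure_eq]
  refine ArzelaAscoli.isCompact_closure_of_isClosedEmbedding (𝔖 := {K | IsCompact K})
    (fun _ hK ↦ hK) ContinuousMap.isUniformEmbedding_toUniformOnFunIsCompact.isClosedEmbedding
    (fun K _ ↦ hequi.equicontinuousOn K) fun K _ x _ ↦ ?_
  let Kx : {K : Set (Fin n → ℂ) // IsCompact K ∧ K ⊆ Ω} :=
    ⟨{(x : Fin n → ℂ)}, isCompact_singleton, singleton_subset_iff.2 x.2⟩
  exact ⟨closedBall 0 (C Kx), isCompact_closedBall _ _,
    fun f hf ↦ mem_closedBall_zero_iff.2 (hf.2 Kx x rfl)⟩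
end

section
/- Compactness of the composition operator: Let Ω be an open subset of ℂⁿ (functions Fin n → ℂ) and γ : Ω → Ω a map which is holomorphic on Ω (each coordinate function is complex differentiable on Ω) and such that the closure of the image γ(Ω) is a compact subset contained in Ω. Then the image under the composition operator f ↦ f ∘ γ of the unit ball { f : f holomorphic on Ω and sup_{x∈Ω} |f(x)| ≤ 1 } is totally bounded for the supremum metric on functions Ω → ℂ; equivalently, the composition operator maps this ball to a precompact subset of the Banach space of bounded continuous functions on Ω. -/
/-- An equicontinuous, pointwise totally bounded family of functions on a compact space is
totally bounded for uniform convergence. -/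
theorem Equicontinuous.totallyBounded_range_uniformFun {ι X α : Type*} [TopologicalSpace X]
    [CompactSpace X] [UniformSpace α] {F : ι → X → α} (hF : Equicontinuous F)
    (hb : ∀ x, TotallyBounded (Set.range fun i => F i x)) :
    TotallyBounded (Set.range (UniformFun.ofFun ∘ F)) := by
  let _ : UniformSpace ι := (Pi.uniformSpace fun _ : X => α).comap F
  have hpi : IsUniformInducing F := ⟨rfl⟩
  have hunif : IsUniformInducing (UniformFun.ofFun ∘ F) := by
    rw [isUniformInducing_iff_uniformSpace]
    exact hF.comap_uniformFun_eq
  have hpt : TotallyBounded (Set.univ : Set ι) := by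
    refine totallyBounded_iff_ultrafilter.2 fun u _ => ?_
    rw [← hpi.cauchy_map_iff, cauchy_pi_iff']
    intro x
    refine totallyBounded_iff_ultrafilter.1 (hb x) (u.map fun i => F i x) ?_
    rw [Filter.le_principal_iff, Ultrafilter.coe_map]
    exact Filter.range_mem_map
  rw [← Set.image_univ]
  exact (totallyBounded_image_iff hunif).2 hpt

/-- The holomorphic functions bounded by `C` on an open set form an equicontinuous family at every
point of that set. -/
theorem equicontinuousAt_of_differentiableOn_of_norm_le {ι E F : Type*} [NormedAddCommGroup E]
    [NormedSpace ℂ E] [NormedAddCommGroup F] [NormedSpace ℂ F] {Ω : Set E} (hΩ : IsOpen Ω)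
    {C : ℝ} {f : ι → E → F} (hf : ∀ i, DifferentiableOn ℂ (f i) Ω)
    (hC : ∀ i, ∀ x ∈ Ω, ‖f i x‖ ≤ C) {x : E} (hx : x ∈ Ω) : EquicontinuousAt f x := by
  obtain ⟨r, hr, hball⟩ := Metric.isOpen_iff.1 hΩ x hx
  refine Metric.equicontinuousAt_of_continuity_modulus (fun y => (C + C) / r * dist y x) ?_ f ?_
  · have hcont : Continuous fun y => (C + C) / r * dist y x := by fun_prop
    simpa using hcont.tendsto x
  · filter_upwards [Metric.ball_mem_nhds x hr] with y hy i
    rw [dist_comm]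
    refine Complex.dist_le_div_mul_dist_of_mapsTo_ball ((hf i).mono hball) (fun z hz => ?_) hy
    rw [Metric.mem_closedBall, dist_eq_norm]
    exact (norm_sub_le _ _).trans (add_le_add (hC i z (hball hz)) (hC i x hx))

open UniformFun in
/-- if `γ : Ω → Ω` is holomorphic on the open set `Ω ⊆ ℂⁿ` with `closure (γ '' Ω)`
compact and contained in `Ω`, then the composition operator `f ↦ f ∘ γ` maps the unit ball of
holomorphic functions bounded by `1` on `Ω` to a totally bounded subset of the functions
`Ω → ℂ` with the uniform (sup) structure. -/
theorem composition_operator_totallyBounded (n : ℕ) (Ω : Set (Fin n → ℂ)) (hΩ : IsOpen Ω)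
    (γ : (Fin n → ℂ) → (Fin n → ℂ)) (hγΩ : Set.MapsTo γ Ω Ω)
    (hγ : DifferentiableOn ℂ γ Ω)
    (hcpt : IsCompact (closure (γ '' Ω))) (hsub : closure (γ '' Ω) ⊆ Ω) :
    TotallyBounded
      ((fun f : (Fin n → ℂ) → ℂ => UniformFun.ofFun (fun x : Ω => f (γ x))) ''
        {f : (Fin n → ℂ) → ℂ | DifferentiableOn ℂ f Ω ∧ ∀ x ∈ Ω, ‖f x‖ ≤ 1} :
        Set (UniformFun ↥Ω ℂ)) := by
  have : CompactSpace ↥(closure (γ '' Ω)) := isCompact_iff_compactSpace.1 hcpt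
  let B := {f : (Fin n → ℂ) → ℂ | DifferentiableOn ℂ f Ω ∧ ∀ x ∈ Ω, ‖f x‖ ≤ 1}
  let F : B → ↥(closure (γ '' Ω)) → ℂ := fun f y => f.1 y
  have hF : Equicontinuous F := fun y U hU =>
    continuousAt_subtype_val.eventually
      (equicontinuousAt_of_differentiableOn_of_norm_le (f := fun f : B => f.1) hΩ
        (fun f => f.2.1) (fun f => f.2.2) (hsub y.2) U hU)
  have hb : ∀ y, TotallyBounded (Set.range fun f => F f y) := fun y =>
    (isCompact_closedBall (0 : ℂ) 1).totallyBounded.subset <| by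
      rintro _ ⟨f, rfl⟩
      simpa using f.2.2 y (hsub y.2)
  let g : Ω → ↥(closure (γ '' Ω)) := fun x =>
    ⟨γ x, subset_closure (Set.mem_image_of_mem γ x.2)⟩
  refine ((hF.totallyBounded_range_uniformFun hb).image
    (UniformFun.precomp_uniformContinuous (f := g))).subset ?_
  rintro _ ⟨f, hf, rfl⟩
  exact ⟨_, ⟨⟨f, hf⟩, rfl⟩, rfl⟩
end

section
/- On bounded families of holomorphic functions, convergence of all Taylor coefficients at one point implies locally uniform convergence: let Ω ⊆ ℂ be a connected open set, x₀ ∈ Ω, and let (f_j)_{j∈ℕ} and f be holomorphic functions on Ω such that for every compact K ⊆ Ω there is a constant C_K with |f_j(x)| ≤ C_K and |f(x)| ≤ C_K for all j and all x ∈ K. If for every k ∈ ℕ the iterated derivatives at x₀ converge, i.e. (deriv^[k] f_j)(x₀) → (deriv^[k] f)(x₀) as j → ∞, then f_j converges to f uniformly on every compact subset of Ω. -/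
open Filter Topology Metric
open scoped Nat

/-- Iterated derivatives of a locally uniformly convergent family of holomorphic functions converge
locally uniformly. -/
theorem TendstoLocallyUniformlyOn.iterate_deriv {ι E : Type*} [NormedAddCommGroup E]
    [NormedSpace ℂ E] [CompleteSpace E] {l : Filter ι} {U : Set ℂ} {F : ι → ℂ → E} {f : ℂ → E}
    (h : TendstoLocallyUniformlyOn F f l U) (hF : ∀ᶠ i in l, DifferentiableOn ℂ (F i) U)
    (hU : IsOpen U) (k : ℕ) :
    TendstoLocallyUniformlyOn (fun i => _root_.deriv^[k] (F i)) (_root_.deriv^[k] f) l U := by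
  induction k generalizing F f with
  | zero => exact h
  | succ k ih => exact ih (h.deriv hF hU) (hF.mono fun i hi => hi.deriv hU)

/-- On a disc, pointwise convergence of the Taylor coefficients at the center of a bounded family of
holomorphic functions implies uniform convergence on every smaller concentric disc. -/
theorem tendstoUniformlyOn_ball_of_tendsto_iteratedDeriv {ι E : Type*} [NormedAddCommGroup E]
    [NormedSpace ℂ E] [CompleteSpace E] {l : Filter ι} {F : ι → ℂ → E} {f : ℂ → E} {c : ℂ}
    {r R C : ℝ} (hr : 0 < r) (hrR : r < R)
    (hF : ∀ i, DifferentiableOn ℂ (F i) (closedBall c R))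
    (hf : DifferentiableOn ℂ f (closedBall c R))
    (hFC : ∀ i, ∀ z ∈ closedBall c R, ‖F i z‖ ≤ C) (hfC : ∀ z ∈ closedBall c R, ‖f z‖ ≤ C)
    (h : ∀ k, Tendsto (fun i => iteratedDeriv k (F i) c) l (𝓝 (iteratedDeriv k f c))) :
    TendstoUniformlyOn F f l (ball c r) := by
  have hR : 0 < R := hr.trans hrR
  have cauchy {g : ℂ → E} (hg : DifferentiableOn ℂ g (closedBall c R))
      (hgC : ∀ z ∈ closedBall c R, ‖g z‖ ≤ C) (n : ℕ) :
      ‖iteratedDeriv n g c‖ ≤ n ! * C / R ^ n :=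
    Complex.norm_iteratedDeriv_le_of_forall_mem_sphere_norm_le n hR
      (DifferentiableOn.diffContOnCl (hg.mono closure_ball_subset_closedBall))
      fun z hz => hgC z (sphere_subset_closedBall hz)
  let a (i : ι) (n : ℕ) : ℝ :=
    (n ! : ℝ)⁻¹ * r ^ n * ‖iteratedDeriv n (F i) c - iteratedDeriv n f c‖
  have ha_nonneg (i n) : 0 ≤ a i n := by positivity
  have ha_le (i n) : a i n ≤ 2 * C * (r / R) ^ n := by
    have key : ‖iteratedDeriv n (F i) c - iteratedDeriv n f c‖ ≤
        n ! * C / R ^ n + n ! * C / R ^ n :=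
      (norm_sub_le _ _).trans (add_le_add (cauchy (hF i) (hFC i) n) (cauchy hf hfC n))
    calc a i n ≤ (n ! : ℝ)⁻¹ * r ^ n * (n ! * C / R ^ n + n ! * C / R ^ n) := by
          exact mul_le_mul_of_nonneg_left key (by positivity)
      _ = 2 * C * (r / R) ^ n := by
          have : (n ! : ℝ) ≠ 0 := by positivity
          rw [div_pow]
          field_simp
          ring
  have hsum : Summable fun n : ℕ => 2 * C * (r / R) ^ n :=
    (summable_geometric_of_lt_one (by positivity) ((div_lt_one hR).2 hrR)).mul_left _
  have ha_summable (i) : Summable (a i) := hsum.of_nonneg_of_le (ha_nonneg i) (ha_le i)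
  have hlim : Tendsto (fun i => ∑' n, a i n) l (𝓝 0) := by
    have := tendsto_tsum_of_dominated_convergence (f := a) (g := fun _ => 0) (𝓕 := l) hsum
      (fun n => by
        simpa using (((h n).sub_const (iteratedDeriv n f c)).norm.const_mul ((n ! : ℝ)⁻¹ * r ^ n)))
      (.of_forall fun i n => by
        rw [Real.norm_of_nonneg (ha_nonneg i n)]
        exact ha_le i n)
    simpa using this
  have dist_le (i) {z : ℂ} (hz : z ∈ ball c r) : dist (f z) (F i z) ≤ ∑' n, a i n := by
    have hzR : z ∈ ball c R := ball_subset_ball hrR.le hz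
    have hs := (Complex.hasSum_taylorSeries_on_ball ((hF i).mono ball_subset_closedBall) hzR).sub
      (Complex.hasSum_taylorSeries_on_ball (hf.mono ball_subset_closedBall) hzR)
    rw [dist_comm, dist_eq_norm, ← hs.tsum_eq]
    refine tsum_of_norm_bounded (ha_summable i).hasSum fun n => ?_
    rw [← smul_sub, ← smul_sub, norm_smul, norm_smul, norm_inv, norm_pow, ← mul_assoc,
      Complex.norm_natCast]
    have : ‖z - c‖ ≤ r := (mem_ball_iff_norm.1 hz).le
    simp only [a]
    gcongr
  rw [Metric.tendstoUniformlyOn_iff]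
  intro ε hε
  filter_upwards [hlim.eventually_lt_const hε] with i hi z hz
  exact (dist_le i hz).trans_lt hi

/-- on a connected open set `Ω ⊆ ℂ`, for a locally uniformly bounded family of
holomorphic functions `f_j` and a holomorphic `g`, convergence of all iterated derivatives
at one point `x₀ ∈ Ω` implies locally uniform convergence `f_j → g` on `Ω`. -/
theorem taylor_coeff_convergence_implies_locUniform (Ω : Set ℂ) (hΩ : IsOpen Ω)
    (hconn : IsConnected Ω) (x₀ : ℂ) (hx₀ : x₀ ∈ Ω)
    (f : ℕ → ℂ → ℂ) (g : ℂ → ℂ)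
    (hf : ∀ j : ℕ, DifferentiableOn ℂ (f j) Ω) (hg : DifferentiableOn ℂ g Ω)
    (hbdd : ∀ K : Set ℂ, K ⊆ Ω → IsCompact K → ∃ C : ℝ,
      (∀ j : ℕ, ∀ x ∈ K, ‖f j x‖ ≤ C) ∧ ∀ x ∈ K, ‖g x‖ ≤ C)
    (hderiv : ∀ k : ℕ, Filter.Tendsto (fun j => deriv^[k] (f j) x₀) Filter.atTop
      (nhds (deriv^[k] g x₀))) :
    TendstoLocallyUniformlyOn f g Filter.atTop Ω := by
  have uniform {c : ℂ} {r R : ℝ} (hr : 0 < r) (hrR : r < R) (hR : closedBall c R ⊆ Ω)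
      (hc : ∀ k, Tendsto (fun j => deriv^[k] (f j) c) atTop (𝓝 (deriv^[k] g c))) :
      TendstoUniformlyOn f g atTop (ball c r) := by
    obtain ⟨C, hfC, hgC⟩ := hbdd _ hR (isCompact_closedBall c R)
    refine tendstoUniformlyOn_ball_of_tendsto_iteratedDeriv hr hrR (fun j => (hf j).mono hR)
      (hg.mono hR) hfC hgC fun k => ?_
    simpa only [iteratedDeriv_eq_iterate] using hc k
  let u : Set ℂ := {z | ∀ᶠ w in 𝓝 z, ∀ k,
    Tendsto (fun j => deriv^[k] (f j) w) atTop (𝓝 (deriv^[k] g w))}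
  have ball_subset {c : ℂ} {r R : ℝ} (hr : 0 < r) (hrR : r < R) (hR : closedBall c R ⊆ Ω)
      (hc : ∀ k, Tendsto (fun j => deriv^[k] (f j) c) atTop (𝓝 (deriv^[k] g c))) :
      ball c r ⊆ u := by
    intro z hz
    filter_upwards [isOpen_ball.mem_nhds hz] with w hw k
    have hsub : ball c r ⊆ Ω := ((ball_subset_ball hrR.le).trans ball_subset_closedBall).trans hR
    exact ((uniform hr hrR hR hc).tendstoLocallyUniformlyOn.iterate_deriv
      (.of_forall fun j => (hf j).mono hsub) isOpen_ball k).tendsto_at hw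
  have exists_closedBall {z : ℂ} (hz : z ∈ Ω) : ∃ R > 0, closedBall z R ⊆ Ω :=
    nhds_basis_closedBall.mem_iff.1 (hΩ.mem_nhds hz)
  have hΩu : Ω ⊆ u := by
    refine hconn.isPreconnected.subset_of_closure_inter_subset isOpen_setOfPred_eventually_nhds
      ⟨x₀, hx₀, ?_⟩ ?_
    · obtain ⟨R, hR, hRΩ⟩ := exists_closedBall hx₀
      exact ball_subset (half_pos hR) (half_lt_self hR) hRΩ hderiv (mem_ball_self (half_pos hR))
    · rintro z ⟨hzu, hzΩ⟩
      obtain ⟨R, hR, hRΩ⟩ := exists_closedBall hzΩ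
      obtain ⟨w, hwu, hzw⟩ := Metric.mem_closure_iff.1 hzu (R / 3) (by positivity)
      refine ball_subset (c := w) (r := R / 3) (R := R / 2) (by positivity) (by linarith)
        ((closedBall_subset_closedBall' ?_).trans hRΩ) (Eventually.self_of_nhds hwu) hzw
      rw [dist_comm]
      linarith
  intro s hs z hz
  obtain ⟨R, hR, hRΩ⟩ := exists_closedBall hz
  exact ⟨ball z (R / 2), mem_nhdsWithin_of_mem_nhds (ball_mem_nhds z (half_pos hR)),
    uniform (half_pos hR) (half_lt_self hR) hRΩ (Eventually.self_of_nhds (hΩu hz)) s hs⟩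
end

section
/- Proper discontinuity of the cyclic group action defining a linear Hopf manifold: let A be an invertible continuous linear map of ℂᴺ (functions Fin N → ℂ) such that every element of the spectrum of A has absolute value strictly less than 1. Then for every compact subset K of ℂᴺ \ {0}, the set of integers k such that (A^k)(K) ∩ K ≠ ∅ is finite. -/
open Filter Topology in
/-- In a complex Banach algebra, the powers of an element of spectral radius less than one
tend to zero. -/
theorem tendsto_norm_pow_of_spectralRadius_lt_one {R : Type*} [NormedRing R] [NormedAlgebra ℂ R]
    [CompleteSpace R] {a : R} (ha : spectralRadius ℂ a < 1) :
    Tendsto (fun n : ℕ => ‖a ^ n‖) atTop (𝓝 0) := by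
  obtain ⟨r, har, hr⟩ := ENNReal.lt_iff_exists_nnreal_btwn.1 ha
  have hr1 : (r : ℝ) < 1 := by exact_mod_cast hr
  refine squeeze_zero' (Eventually.of_forall fun n => norm_nonneg _) ?_
    (tendsto_pow_atTop_nhds_zero_of_lt_one r.coe_nonneg hr1)
  filter_upwards [(spectrum.pow_nnnorm_pow_one_div_tendsto_nhds_spectralRadius a).eventually_lt_const
    har, eventually_gt_atTop 0] with n hn hn0
  have hn0' : (0 : ℝ) < n := by exact_mod_cast hn0
  have h := (ENNReal.rpow_le_rpow_iff hn0').2 hn.le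
  rw [← ENNReal.rpow_mul, one_div_mul_cancel hn0'.ne', ENNReal.rpow_one,
    ENNReal.rpow_natCast] at h
  exact_mod_cast h

/-- Powers of a continuous linear equivalence act as the powers of the underlying map. -/
theorem ContinuousLinearEquiv.pow_apply_eq_coe_pow {𝕜 E : Type*} [Semiring 𝕜] [AddCommMonoid E]
    [Module 𝕜 E] [TopologicalSpace E] (A : E ≃L[𝕜] E) (n : ℕ) (x : E) :
    (A ^ n) x = ((A : E →L[𝕜] E) ^ n) x := by
  induction n generalizing x with
  | zero => rfl
  | succ n ih =>
    rw [pow_succ, pow_succ]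
    exact ih (A x)


/-- proper discontinuity of the Hopf action: if `A` is an invertible continuous
linear map of `ℂᴺ` whose spectrum lies strictly inside the unit disc, then for every compact
`K ⊆ ℂᴺ \ {0}` the set of integers `k` with `(A^k)(K) ∩ K ≠ ∅` is finite. -/
theorem hopf_action_properly_discontinuous (N : ℕ) (A : (Fin N → ℂ) ≃L[ℂ] (Fin N → ℂ))
    (hspec : ∀ μ ∈ spectrum ℂ (A : (Fin N → ℂ) →L[ℂ] (Fin N → ℂ)), ‖μ‖ < 1)
    (K : Set (Fin N → ℂ)) (hK : IsCompact K) (hK0 : K ⊆ {0}ᶜ) :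
    {k : ℤ | ((A ^ k) '' K ∩ K).Nonempty}.Finite := by
  rcases K.eq_empty_or_nonempty with rfl | ⟨x₀, hx₀⟩
  · simp
  have : Nontrivial (Fin N → ℂ) := ⟨x₀, 0, hK0 hx₀⟩
  let T : (Fin N → ℂ) →L[ℂ] (Fin N → ℂ) := (A : (Fin N → ℂ) →L[ℂ] (Fin N → ℂ))
  have hrad : spectralRadius ℂ T < 1 := by
    exact_mod_cast spectrum.spectralRadius_lt_of_forall_lt T (r := 1)
      fun μ hμ => by exact_mod_cast hspec μ hμ
  obtain ⟨M, hM⟩ := hK.isBounded.exists_norm_le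
  obtain ⟨y₀, hy₀, hmin⟩ := hK.exists_isMinOn ⟨x₀, hx₀⟩ continuous_norm.continuousOn
  have hδ : 0 < ‖y₀‖ := norm_pos_iff.2 (hK0 hy₀)
  have hlim := (tendsto_norm_pow_of_spectralRadius_lt_one hrad).mul_const M
  rw [zero_mul] at hlim
  obtain ⟨n₀, hn₀⟩ := Filter.eventually_atTop.1 (hlim.eventually_lt_const hδ)
  have key : ∀ n : ℕ, ∀ x ∈ K, (A ^ n) x ∈ K → n < n₀ := by
    intro n x hx hy
    by_contra! hn
    have h : ‖y₀‖ ≤ ‖(A ^ n) x‖ := hmin hy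
    rw [A.pow_apply_eq_coe_pow] at h
    have h' : ‖(T ^ n) x‖ ≤ ‖T ^ n‖ * M :=
      (T ^ n).le_opNorm_of_le (hM x hx)
    exact absurd (hn₀ n hn) (h.trans h').not_gt
  refine (Set.finite_Ioo (-(n₀ : ℤ)) n₀).subset ?_
  rintro k ⟨_, ⟨x, hx, rfl⟩, hy⟩
  obtain ⟨n, rfl | rfl⟩ := k.eq_nat_or_neg
  · have := key n x hx (by simpa only [zpow_natCast] using hy)
    constructor <;> omega
  · have hback : (A ^ n) ((A ^ (-(n : ℤ))) x) = x := by
      rw [zpow_neg, zpow_natCast]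
      exact (A ^ n).apply_symm_apply x
    have := key n _ hy (by rwa [hback])
    constructor <;> omega
end
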